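/- arXiv:1705.04509 — 3 statements merged into one kernel-verified Lean document; each statement's English description precedes it below -/
import Mathlib

section
/- Let M, K, r, n be natural numbers with 1 ≤ K ≤ M, r ≥ 1, and n ≤ M − K. If r random K-element subsets of an M-element set are chosen independently, each uniformly at random among all C(M, K) K-element subsets, then the probability that the complement of their union has exactly n elements (i.e., exactly n channels are left untouched) equals C(M, n) · ∑_{v=0}^{M−n−K} (−1)^v · C(M − n, v) · (C(M − n − v, K) / C(M, K))^r. -/
/-- The number of `r`-tuples of `K`-element sets that all avoid a fixed set `A`. -/
theorem card_filter_subset_compl_biUnion {α : Type*} [Fintype α] [DecidableEq α] (K r : ℕ)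
    (A : Finset α) :
    (Finset.univ.filter (fun f : Fin r → {s : Finset α // s.card = K} =>
      A ⊆ Finset.univ \ Finset.univ.biUnion (fun i => (f i : Finset α)))).card =
      ((Fintype.card α - A.card).choose K) ^ r := by
  have hset : Finset.univ.filter (fun f : Fin r → {s : Finset α // s.card = K} =>
      A ⊆ Finset.univ \ Finset.univ.biUnion (fun i => (f i : Finset α))) =
      Fintype.piFinset (fun _ : Fin r =>
        Finset.univ.filter (fun s : {s : Finset α // s.card = K} => (s : Finset α) ⊆ Aᶜ)) := by
    ext f
    simp only [Finset.mem_filter, Finset.mem_univ, true_and, Fintype.mem_piFinset,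
      Finset.subset_iff, Finset.mem_sdiff, Finset.mem_biUnion, Finset.mem_compl]
    grind
  have hcard : (Finset.univ.filter
      (fun s : {s : Finset α // s.card = K} => (s : Finset α) ⊆ Aᶜ)).card =
      (Fintype.card α - A.card).choose K := by
    rw [← Finset.card_compl, ← Finset.card_powersetCard,
      ← Finset.card_map (Function.Embedding.subtype _)]
    congr 1
    ext s
    simp [Finset.mem_powersetCard, and_comm]
  rw [hset, Fintype.card_piFinset_const, hcard]

/-- The binomial moments of the number of elements left untouched by `r` sets of size `K`. -/
theorem sum_choose_card_compl_biUnion {α : Type*} [Fintype α] [DecidableEq α] (K r m : ℕ) :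
    ∑ f : Fin r → {s : Finset α // s.card = K},
      (Finset.univ \ Finset.univ.biUnion (fun i => (f i : Finset α))).card.choose m =
      (Fintype.card α).choose m * ((Fintype.card α - m).choose K) ^ r := by
  have hchoose (U : Finset α) : U.card.choose m =
      ∑ A ∈ Finset.powersetCard m Finset.univ, if A ⊆ U then 1 else 0 := by
    rw [← Finset.card_powersetCard, ← Finset.card_filter]
    congr 1
    ext A
    simp [Finset.mem_powersetCard, and_comm]
  simp_rw [hchoose]
  rw [Finset.sum_comm]
  simp_rw [← Finset.card_filter, card_filter_subset_compl_biUnion]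
  rw [Finset.sum_congr rfl (g := fun _ => ((Fintype.card α - m).choose K) ^ r)
    (fun A hA => by rw [(Finset.mem_powersetCard.1 hA).2])]
  simp

/-- The indicator of `u = n` as an alternating sum of binomial coefficients of `u`. -/
theorem sum_range_neg_one_pow_mul_choose_mul_choose {u n N : ℕ} (huN : u ≤ n + N) :
    ∑ v ∈ Finset.range (N + 1), (-1 : ℤ) ^ v * ((u.choose (n + v) * (n + v).choose n : ℕ) : ℤ) =
      if u = n then 1 else 0 := by
  have hmul (v : ℕ) : u.choose (n + v) * (n + v).choose n = u.choose n * (u - n).choose v := by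
    simpa using Nat.choose_mul (n := u) (k := n + v) (s := n) (Nat.le_add_right n v)
  have htrunc : ∑ v ∈ Finset.range (N + 1), (-1 : ℤ) ^ v * ((u - n).choose v : ℤ) =
      ∑ v ∈ Finset.range (u - n + 1), (-1 : ℤ) ^ v * ((u - n).choose v : ℤ) := by
    symm
    refine Finset.sum_subset (Finset.range_mono (by lia)) fun v _ hv => ?_
    rw [Nat.choose_eq_zero_of_lt (by simpa [Nat.succ_le_iff] using hv)]
    simp
  simp_rw [hmul]
  push_cast
  simp_rw [mul_left_comm _ (u.choose n : ℤ)]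
  rw [← Finset.mul_sum, htrunc, Int.alternating_sum_range_choose]
  rcases lt_trichotomy u n with h | rfl | h
  · simp [Nat.choose_eq_zero_of_lt h, h.ne]
  · simp
  · simp [h.ne', Nat.sub_eq_zero_iff_le, h]

/-- The number of `r`-tuples of `K`-element sets leaving exactly `n` elements untouched. -/
theorem card_filter_card_compl_biUnion {α : Type*} [Fintype α] [DecidableEq α] (K r n : ℕ)
    (hn : n ≤ Fintype.card α) :
    ((Finset.univ.filter (fun f : Fin r → {s : Finset α // s.card = K} =>
      (Finset.univ \ Finset.univ.biUnion (fun i => (f i : Finset α))).card = n)).card : ℤ) =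
      (Fintype.card α).choose n * ∑ v ∈ Finset.range (Fintype.card α - n + 1),
        (-1 : ℤ) ^ v * ((Fintype.card α - n).choose v : ℤ) *
          ((Fintype.card α - n - v).choose K : ℤ) ^ r := by
  rw [Finset.card_filter]
  push_cast
  rw [Finset.sum_congr rfl fun f _ => (sum_range_neg_one_pow_mul_choose_mul_choose
    (N := Fintype.card α - n) (by rw [Nat.add_sub_cancel' hn]; exact Finset.card_le_univ _)).symm,
    Finset.sum_comm, Finset.mul_sum]
  refine Finset.sum_congr rfl fun v _ => ?_
  have hmul : (Fintype.card α).choose (n + v) * (n + v).choose n =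
      (Fintype.card α).choose n * (Fintype.card α - n).choose v := by
    simpa using Nat.choose_mul (n := Fintype.card α) (k := n + v) (s := n) (Nat.le_add_right n v)
  rw [← Finset.mul_sum, ← Nat.cast_sum, ← Finset.sum_mul, sum_choose_card_compl_biUnion,
    mul_right_comm, hmul, Nat.sub_sub]
  push_cast
  ring

/-- If `r` random `K`-element subsets of an `M`-element set are chosen independently and
uniformly at random, the probability that exactly `n` elements are left untouched
(the complement of the union has exactly `n` elements) equals
`C(M,n) ∑_{v=0}^{M-n-K} (-1)^v C(M-n,v) (C(M-n-v,K)/C(M,K))^r`. -/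
theorem stmt2 (M K r n : ℕ) (hK1 : 1 ≤ K) (hKM : K ≤ M) (hr : 1 ≤ r) (hn : n ≤ M - K)
    [Nonempty {s : Finset (Fin M) // s.card = K}] :
    ((PMF.uniformOfFintype (Fin r → {s : Finset (Fin M) // s.card = K})).toOuterMeasure
        {f | (Finset.univ \ Finset.univ.biUnion
          (fun i => ((f i : {s : Finset (Fin M) // s.card = K}) : Finset (Fin M)))).card
            = n}).toReal =
      (M.choose n : ℝ) * ∑ v ∈ Finset.range (M - n - K + 1),
        (-1 : ℝ) ^ v * ((M - n).choose v : ℝ) *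
          (((M - n - v).choose K : ℝ) / (M.choose K : ℝ)) ^ r := by
  classical
  have hcount := congrArg (Int.cast : ℤ → ℝ)
    (card_filter_card_compl_biUnion (α := Fin M) K r n (by simp; lia))
  simp only [Fintype.card_fin] at hcount
  push_cast at hcount
  have htrunc : ∑ v ∈ Finset.range (M - n - K + 1), (-1 : ℝ) ^ v * ((M - n).choose v : ℝ) *
        ((M - n - v).choose K : ℝ) ^ r =
      ∑ v ∈ Finset.range (M - n + 1), (-1 : ℝ) ^ v * ((M - n).choose v : ℝ) *
        ((M - n - v).choose K : ℝ) ^ r := by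
    refine Finset.sum_subset (Finset.range_mono (by lia)) fun v _ hv => ?_
    rw [Finset.mem_range] at hv
    rw [Nat.choose_eq_zero_of_lt (show M - n - v < K by lia)]
    simp [Nat.one_le_iff_ne_zero.1 hr]
  rw [PMF.toOuterMeasure_uniformOfFintype_apply, ENNReal.toReal_div, ENNReal.toReal_natCast,
    ENNReal.toReal_natCast, Fintype.card_fun, Fintype.card_finset_len, Fintype.card_fin,
    Fintype.card_fin, Fintype.card_subtype]
  simp_rw [Set.mem_ofPred_eq, div_pow, mul_div_assoc']
  rw [← Finset.sum_div, mul_div_assoc', htrunc, hcount]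
  push_cast
  rfl
end

section
/- Let M, K, r be natural numbers with 1 ≤ K ≤ M and r ≥ 1. Then ∑_{n=0}^{M−K} C(M, n) · ∑_{v=0}^{M−n−K} (−1)^v · C(M − n, v) · C(M − n − v, K)^r = C(M, K)^r, where C(a, b) denotes the binomial coefficient. -/
/-- Binomial inversion evaluated at one point: the inclusion–exclusion sums of a function `f`,
summed over all sizes of the uncovered set, collapse to `f 0`. -/
theorem sum_choose_mul_sum_alternating_choose (M N : ℕ) (f : ℕ → ℤ) :
    (∑ n ∈ Finset.range (N + 1), ∑ v ∈ Finset.range (N + 1 - n),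
      (M.choose n : ℤ) * ((-1) ^ v * ((M - n).choose v : ℤ) * f (n + v))) = f 0 := by
  rw [← Finset.sum_range_diag_flip (N + 1)
    fun n v => (M.choose n : ℤ) * ((-1) ^ v * ((M - n).choose v : ℤ) * f (n + v))]
  have inner : ∀ s ∈ Finset.range (N + 1),
      (∑ k ∈ Finset.range (s + 1), (M.choose k : ℤ) *
        ((-1) ^ (s - k) * ((M - k).choose (s - k) : ℤ) * f (k + (s - k)))) =
      (M.choose s : ℤ) * f s * 0 ^ s := by
    intro s _
    have binom : (0 : ℤ) ^ s = ∑ k ∈ Finset.range (s + 1), (-1) ^ (s - k) * (s.choose k : ℤ) := by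
      simpa using add_pow (1 : ℤ) (-1) s
    rw [binom, Finset.mul_sum]
    refine Finset.sum_congr rfl fun k hk => ?_
    have hks : k ≤ s := Finset.mem_range_succ_iff.mp hk
    have hchoose : (M.choose s : ℤ) * s.choose k = M.choose k * (M - k).choose (s - k) :=
      mod_cast Nat.choose_mul hks
    rw [Nat.add_sub_cancel' hks]
    linear_combination -(-1) ^ (s - k) * f s * hchoose
  rw [Finset.sum_congr rfl inner, Finset.sum_eq_single 0] <;> simp +contextual

/-- Normalization identity: summing over all possible numbers `n` of untouched channels
the inclusion–exclusion count of sequences of `r` `K`-element subsets of an `M`-element set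
leaving exactly `n` elements uncovered recovers the total number `C(M, K) ^ r`. -/
theorem stmt3 (M K r : ℕ) (hK1 : 1 ≤ K) (hKM : K ≤ M) (hr : 1 ≤ r) :
    (∑ n ∈ Finset.range (M - K + 1), (M.choose n : ℤ) *
        ∑ v ∈ Finset.range (M - n - K + 1),
          (-1 : ℤ) ^ v * ((M - n).choose v : ℤ) * ((M - n - v).choose K : ℤ) ^ r) =
      (M.choose K : ℤ) ^ r := by
  refine Eq.trans ?_ (sum_choose_mul_sum_alternating_choose M (M - K)
    fun s => ((M - s).choose K : ℤ) ^ r)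
  refine Finset.sum_congr rfl fun n hn => ?_
  have hn' : n < M - K + 1 := Finset.mem_range.mp hn
  have hrange : M - n - K + 1 = M - K + 1 - n := by omega
  rw [hrange, Finset.mul_sum]
  simp only [Nat.sub_sub]
end

section
/- Fix a natural number K ≥ 1 and γ ∈ [0, 1], and define F : ℝ → ℝ by F(η) = η·(1 − (1 − (1 − γ)·e^{−Kη})^K). Then for every η ≥ 0, one has F(η) ≤ (1 − γ)/e; in particular F(η) ≤ 1/e. -/
theorem one_sub_one_sub_pow_le_mul {x : ℝ} (hx : x ≤ 2) (n : ℕ) :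
    1 - (1 - x) ^ n ≤ n * x := by
  have h := one_add_mul_le_pow (a := -x) (by linarith) n
  rw [← sub_eq_add_neg 1 x] at h
  linarith

/-- Capacity bound: the sustainable load per channel of the multi-replica system,
`F(η) = η (1 - (1 - (1-γ) e^{-Kη})^K)`, never exceeds `(1-γ)/e ≤ 1/e` for any `η ≥ 0`. -/
theorem stmt11 (K : ℕ) (hK : 1 ≤ K) (γ : ℝ) (hγ0 : 0 ≤ γ) (hγ1 : γ ≤ 1) :
    ∀ η : ℝ, 0 ≤ η →
      η * (1 - (1 - (1 - γ) * Real.exp (-(K : ℝ) * η)) ^ K) ≤ (1 - γ) / Real.exp 1 ∧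
      η * (1 - (1 - (1 - γ) * Real.exp (-(K : ℝ) * η)) ^ K) ≤ 1 / Real.exp 1 := by
  intro η hη
  have hγ : 0 ≤ 1 - γ := sub_nonneg.2 hγ1
  have hexp : Real.exp (-(K : ℝ) * η) ≤ 1 := by
    rw [Real.exp_le_one_iff, neg_mul, neg_nonpos]
    positivity
  have hx : (1 - γ) * Real.exp (-(K : ℝ) * η) ≤ 2 := by
    linarith [mul_le_of_le_one_right hγ hexp]
  have hload : η * (1 - (1 - (1 - γ) * Real.exp (-(K : ℝ) * η)) ^ K) ≤
      (1 - γ) / Real.exp 1 :=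
    calc η * (1 - (1 - (1 - γ) * Real.exp (-(K : ℝ) * η)) ^ K)
        ≤ η * (K * ((1 - γ) * Real.exp (-(K : ℝ) * η))) :=
          mul_le_mul_of_nonneg_left (one_sub_one_sub_pow_le_mul hx K) hη
      _ = (1 - γ) * (K * η * Real.exp (-(K * η))) := by rw [neg_mul]; ring
      _ ≤ (1 - γ) * Real.exp (-1) :=
          mul_le_mul_of_nonneg_left (Real.mul_exp_neg_le_exp_neg_one _) hγ
      _ = (1 - γ) / Real.exp 1 := by rw [Real.exp_neg, div_eq_mul_inv]
  refine ⟨hload, hload.trans ?_⟩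
  gcongr
  linarith
end
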